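/- Let X be a θ-complete, θ-↑↓-closed topologized semilattice. Then X is weak θ-chain•-compact, i.e., X is compact in the topology generated by the subbase consisting of complements of θ-closures of chains in X. -/

import Mathlib

open Set TopologicalSpace

/-- The θ-closure of a set in a topological space. -/
def thetaCl {X : Type*} [TopologicalSpace X] (A : Set X) : Set X :=
  {x | ∀ U : Set X, IsOpen U → x ∈ U → (closure U ∩ A).Nonempty}

theorem thetaCl_mono' {X : Type*} [TopologicalSpace X] {A B : Set X} (h : A ⊆ B) :
    thetaCl A ⊆ thetaCl B :=
  fun _ hx U hU hxU => (hx U hU hxU).mono (inter_subset_inter_right _ h)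

theorem thetaCl_union_sub {X : Type*} [TopologicalSpace X] (A B : Set X) :
    thetaCl (A ∪ B) ⊆ thetaCl A ∪ thetaCl B := by
  intro x hx
  by_contra hcon
  simp only [mem_union, not_or, thetaCl, mem_setOf_eq, not_forall] at hcon
  obtain ⟨⟨U, hU, hxU, hUA⟩, ⟨V, hV, hxV, hVB⟩⟩ := hcon
  obtain ⟨y, hy, hyAB⟩ := hx (U ∩ V) (hU.inter hV) ⟨hxU, hxV⟩
  rcases hyAB with h | h
  · exact hUA ⟨y, closure_mono inter_subset_left hy, h⟩
  · exact hVB ⟨y, closure_mono inter_subset_right hy, h⟩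

theorem thetaCl_sub_ud {X : Type*} [PartialOrder X] [TopologicalSpace X]
    (hud : ∀ x : X, thetaCl {y : X | x ≤ y} = {y : X | x ≤ y} ∧
      thetaCl {y : X | y ≤ x} = {y : X | y ≤ x}) {C : Set X} {a b : X}
    (h : ∀ c ∈ C, c ≤ a ∨ b ≤ c) : ∀ c ∈ thetaCl C, c ≤ a ∨ b ≤ c := by
  intro c hc
  have h1 : C ⊆ {y : X | y ≤ a} ∪ {y : X | b ≤ y} := h
  have h2 := thetaCl_union_sub _ _ (thetaCl_mono' h1 hc)
  rwa [(hud a).2, (hud b).1] at h2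

theorem thetaCl_compar {X : Type*} [PartialOrder X] [TopologicalSpace X]
    (hud : ∀ x : X, thetaCl {y : X | x ≤ y} = {y : X | x ≤ y} ∧
      thetaCl {y : X | y ≤ x} = {y : X | y ≤ x}) {C : Set X} (hC : IsChain (· ≤ ·) C) :
    ∀ d ∈ thetaCl C, ∀ c ∈ C, c ≤ d ∨ d ≤ c := by
  intro d hd c hc
  exact (thetaCl_sub_ud hud (fun e he => hC.total he hc) d hd).symm

theorem thetaCl_chain {X : Type*} [PartialOrder X] [TopologicalSpace X]
    (hud : ∀ x : X, thetaCl {y : X | x ≤ y} = {y : X | x ≤ y} ∧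
      thetaCl {y : X | y ≤ x} = {y : X | y ≤ x}) {C : Set X} (hC : IsChain (· ≤ ·) C) :
    IsChain (· ≤ ·) (thetaCl C) := by
  intro d hd e he _
  exact thetaCl_sub_ud hud (thetaCl_compar hud hC e he) d hd

theorem thetaCl_sup {X : Type*} [PartialOrder X] [TopologicalSpace X]
    (hs : ∀ C : Set X, C.Nonempty → IsChain (· ≤ ·) C → ∃ b, IsLUB C b ∧ b ∈ thetaCl C)
    (hud : ∀ x : X, thetaCl {y : X | x ≤ y} = {y : X | x ≤ y} ∧
      thetaCl {y : X | y ≤ x} = {y : X | y ≤ x}) {C : Set X} (hC : IsChain (· ≤ ·) C)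
    (D : Set X) (hD : D ⊆ thetaCl C) (hne : D.Nonempty) : ∃ b ∈ thetaCl C, IsLUB D b := by
  have hDc : IsChain (· ≤ ·) D := (thetaCl_chain hud hC).mono hD
  obtain ⟨s, hsD, -⟩ := hs D hne hDc
  by_cases hsm : s ∈ D
  · exact ⟨s, hD hsm, hsD⟩
  have hnext : ∀ d ∈ D, ∃ d' ∈ D, ¬ d' ≤ d := by
    intro d hd
    by_contra! hcon
    exact hsm (le_antisymm (hsD.2 hcon) (hsD.1 hd) ▸ hd)
  have hcof : ∀ d ∈ D, ∃ c ∈ C, (∃ e ∈ D, c ≤ e) ∧ d ≤ c := by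
    intro d hd
    obtain ⟨d', hd', h1⟩ := hnext d hd
    obtain ⟨e, he, h2⟩ := hnext d' hd'
    by_contra! hcon
    have h3 : ∀ c ∈ C, c ≤ d ∨ e ≤ c := by
      intro c hc
      rcases thetaCl_compar hud hC e (hD he) c hc with h | h
      · exact Or.inl ((thetaCl_compar hud hC d (hD hd) c hc).resolve_right
          (hcon c hc ⟨e, he, h⟩))
      · exact Or.inr h
    exact (thetaCl_sub_ud hud h3 d' (hD hd')).elim h1 h2
  obtain ⟨d0, hd0⟩ := hne
  obtain ⟨c0, hc0, hc0', -⟩ := hcof d0 hd0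
  obtain ⟨b, hb, hbc⟩ := hs {c | c ∈ C ∧ ∃ e ∈ D, c ≤ e} ⟨c0, hc0, hc0'⟩
    (hC.mono fun _ h => h.1)
  refine ⟨b, thetaCl_mono' (fun _ h => h.1) hbc, ?_, ?_⟩
  · intro d hd
    obtain ⟨c, hc, h, hdc⟩ := hcof d hd
    exact hdc.trans (hb.1 ⟨hc, h⟩)
  · intro u hu
    apply hb.2
    rintro c ⟨_, e, he, hce⟩
    exact hce.trans (hu he)

theorem isChain_dual {X : Type*} [PartialOrder X] {C : Set X}
    (h : IsChain (fun a b : X => b ≤ a) C) : IsChain (· ≤ ·) C :=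
  fun _ ha _ hb hne => (h ha hb hne).symm

theorem isChain_dual' {X : Type*} [PartialOrder X] {C : Set X}
    (h : IsChain (· ≤ ·) C) : IsChain (fun a b : X => b ≤ a) C :=
  fun _ ha _ hb hne => (h ha hb hne).symm

theorem thetaCl_inf {X : Type*} [PartialOrder X] [t : TopologicalSpace X]
    (hs : ∀ C : Set X, C.Nonempty → IsChain (· ≤ ·) C → ∃ b, IsGLB C b ∧ b ∈ thetaCl C)
    (hud : ∀ x : X, thetaCl {y : X | x ≤ y} = {y : X | x ≤ y} ∧
      thetaCl {y : X | y ≤ x} = {y : X | y ≤ x}) {C : Set X} (hC : IsChain (· ≤ ·) C)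
    (D : Set X) (hD : D ⊆ thetaCl C) (hne : D.Nonempty) : ∃ b ∈ thetaCl C, IsGLB D b :=
  @thetaCl_sup X (inferInstanceAs (PartialOrder Xᵒᵈ)) t
    (fun C hne hC => hs C hne (isChain_dual hC)) (fun x => ⟨(hud x).2, (hud x).1⟩) C
    (isChain_dual' hC) D hD hne

/-- Complete subchain. -/
def Cpl {X : Type*} [PartialOrder X] (A : Set X) : Prop :=
  ∀ D ⊆ A, D.Nonempty → (∃ a ∈ A, IsGLB D a) ∧ ∃ b ∈ A, IsLUB D b

theorem Cpl.inter {X : Type*} [PartialOrder X] {A B : Set X} (hA : Cpl A) (hB : Cpl B) :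
    Cpl (A ∩ B) := by
  intro D hD hne
  obtain ⟨⟨a, ha, ha'⟩, b, hb, hb'⟩ := hA D (hD.trans inter_subset_left) hne
  obtain ⟨⟨c, hc, hc'⟩, d, hd, hd'⟩ := hB D (hD.trans inter_subset_right) hne
  exact ⟨⟨a, ⟨ha, ha'.unique hc' ▸ hc⟩, ha'⟩, b, ⟨hb, hb'.unique hd' ▸ hd⟩, hb'⟩

/-- A θ-complete, θ-↑↓-closed topologized semilattice is compact in the
weak θ-chain•-topology (generated by the complements of θ-closures of chains). -/
theorem theta_complete_weak_theta_chain_compact {X : Type*} [SemilatticeInf X]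
    [t : TopologicalSpace X]
    (hθ : ∀ C : Set X, C.Nonempty → IsChain (· ≤ ·) C →
      ∃ a b : X, IsGLB C a ∧ IsLUB C b ∧ a ∈ thetaCl C ∧ b ∈ thetaCl C)
    (hud : ∀ x : X, thetaCl {y : X | x ≤ y} = {y : X | x ≤ y} ∧
      thetaCl {y : X | y ≤ x} = {y : X | y ≤ x}) :
    @CompactSpace X (generateFrom
      {U : Set X | ∃ C : Set X, IsChain (· ≤ ·) C ∧ U = (thetaCl C)ᶜ}) := by
  have hcpl : ∀ C : Set X, IsChain (· ≤ ·) C → Cpl (thetaCl C) := by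
    intro C hC D hD hne
    refine ⟨thetaCl_inf (fun C h1 h2 => ?_) hud hC D hD hne,
      thetaCl_sup (fun C h1 h2 => ?_) hud hC D hD hne⟩
    · obtain ⟨a, b, h⟩ := hθ C h1 h2
      exact ⟨a, h.1, h.2.2.1⟩
    · obtain ⟨a, b, h⟩ := hθ C h1 h2
      exact ⟨b, h.2.1, h.2.2.2⟩
  have key : ∀ F : Ultrafilter X, ∃ x : X, ∀ C : Set X, IsChain (· ≤ ·) C →
      thetaCl C ∈ F → x ∈ thetaCl C := by
    intro F
    by_cases hex : ∃ C : Set X, IsChain (· ≤ ·) C ∧ thetaCl C ∈ F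
    swap
    · obtain ⟨x, -⟩ := F.nonempty_of_mem Filter.univ_mem
      exact ⟨x, fun C hC h => (hex ⟨C, hC, h⟩).elim⟩
    obtain ⟨C0, hC0, hF0⟩ := hex
    have hleast : ∀ A ∈ F, Cpl A → ∃ m, IsLeast A m := by
      intro A hA hc
      obtain ⟨⟨a, ha, ha'⟩, -⟩ := hc A subset_rfl (F.nonempty_of_mem hA)
      exact ⟨a, ha, ha'.1⟩
    let M : Set X → Set X := fun L =>
      {m | ∃ A ∈ F, Cpl A ∧ A ⊆ thetaCl C0 ∩ L ∧ IsLeast A m}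
    have hMne : ∀ L ∈ F, Cpl L → (M L).Nonempty := by
      intro L hL hc
      have h1 : thetaCl C0 ∩ L ∈ F := Filter.inter_mem hF0 hL
      have h2 := (hcpl C0 hC0).inter hc
      obtain ⟨m, hm⟩ := hleast _ h1 h2
      exact ⟨m, _, h1, h2, subset_rfl, hm⟩
    have hMsub : ∀ L, M L ⊆ thetaCl C0 ∩ L := by
      rintro L m ⟨A, _, _, hs, hm⟩
      exact hs hm.1
    obtain ⟨-, s, -, hs⟩ := hcpl C0 hC0 (M (thetaCl C0))
      ((hMsub _).trans inter_subset_left) (hMne _ hF0 (hcpl C0 hC0))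
    refine ⟨s, fun C hC hF => ?_⟩
    obtain ⟨-, b, hb, hb'⟩ := hcpl C hC (M (thetaCl C))
      ((hMsub _).trans inter_subset_right) (hMne _ hF (hcpl C hC))
    have : s = b := by
      apply le_antisymm
      · apply hs.2
        rintro m ⟨A, hA, hc, hsub, hm⟩
        have h1 : A ∩ thetaCl C ∈ F := Filter.inter_mem hA hF
        have h2 := hc.inter (hcpl C hC)
        obtain ⟨m', hm'⟩ := hleast _ h1 h2
        exact (hm.2 hm'.1.1).trans (hb'.1 ⟨_, h1, h2,
          fun x hx => ⟨(hsub hx.1).1, hx.2⟩, hm'⟩)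
      · apply hb'.2
        rintro m ⟨A, hA, hc, hsub, hm⟩
        exact hs.1 ⟨A, hA, hc, fun x hx => ⟨(hsub hx).1, (hsub hx).1⟩, hm⟩
    exact this ▸ hb
  refine @CompactSpace.mk X (_) ?_
  refine (@isCompact_iff_ultrafilter_le_nhds X (_) _).2 fun F _ => ?_
  obtain ⟨x, hx⟩ := key F
  refine ⟨x, mem_univ x, ?_⟩
  rw [nhds_generateFrom]
  refine le_iInf₂ fun U hU => ?_
  obtain ⟨hxU, C, hC, rfl⟩ := hU
  rw [Filter.le_principal_iff]
  exact Ultrafilter.compl_mem_iff_notMem.2 fun h => hxU (hx C hC h)
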